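/- Let P' be a decreasing tableau, x a positive integer, and P the result of Hecke column insertion of x into P', with the insertion ending at column c. Then the right keys K_+(P) and K_+(P') agree in every column except possibly column c; and if the insertion causes no box to be added (a contraction), then K_+(P) = K_+(P'). -/

import Mathlib

open scoped Classical

noncomputable section

/-- The `⋆` column-bumping action of a single letter `m` on a finite set `S`. -/
def starLetter (S : Finset ℕ) (m : ℕ) : Finset ℕ :=
  if h : (S.filter (fun s => m ≤ s)).Nonempty then
    insert m (S.erase ((S.filter (fun s => m ≤ s)).min' h))
  else insert m S

/-- The `⋆` action of a word, letter by letter from the left. -/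
def star (S : Finset ℕ) (w : List ℕ) : Finset ℕ :=
  w.foldl starLetter S

/-- A decreasing tableau, represented by its list of columns (each column listed
top to bottom). -/
def IsDecTab (T : List (List ℕ)) : Prop :=
  (∀ col ∈ T, List.Chain' (· > ·) col) ∧
  List.Chain' (fun C D : List ℕ => D.length ≤ C.length ∧
    ∀ r : ℕ, r < D.length → D.getD r 0 < C.getD r 0) T

/-- The column reading word: each column read bottom to top, columns left to right. -/
def colWord (T : List (List ℕ)) : List ℕ :=
  (T.map List.reverse).flatten

/-- The `j`-th column (0-indexed) of the right key `K₊(T)`: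
`∅ ⋆ word(T_{≥ j})`, where `T_{≥ j}` drops the first `j` columns of `T`. -/
def Kcol (T : List (List ℕ)) (j : ℕ) : Finset ℕ :=
  star ∅ (colWord (T.drop j))

/-- Replace column `c` of `T` by `C` (appending a new column if `c = T.length`). -/
def setCol (T : List (List ℕ)) (c : ℕ) (C : List ℕ) : List (List ℕ) :=
  if c < T.length then T.set c C else T ++ [C]

/-- The column index of the rightmost box in row `r` of `T`. -/
def rowEnd (T : List (List ℕ)) (r : ℕ) : ℕ :=
  (T.filter (fun col => decide (r < col.length))).length - 1

/-- Hecke column insertion of `x`, starting at column `c` (fuelled recursion;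
the fuel is always sufficient when larger than the number of columns).
Returns the resulting tableau, the column index of the box where the insertion
ends, and whether a new box was added (`false` means a contraction occurred). -/
def heckeGo : ℕ → List (List ℕ) → ℕ → ℕ → List (List ℕ) × ℕ × Bool
  | 0, T, c, _ => (T, c, false)
  | fuel + 1, T, c, x =>
    let C := T.getD c []
    if ∀ y ∈ C, x ≤ y then
      let T' := setCol T c (C ++ [x])
      if IsDecTab T' then (T', c, true)
      else (T, rowEnd T (C.length - 1), false)
    else
      let y := (C.filter (fun z => decide (z < x))).foldr max 0
      let C' := C.map (fun z => if z = y then x else z)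
      let T' := if IsDecTab (T.set c C') then T.set c C' else T
      heckeGo fuel T' (c + 1) y

/-- Hecke column insertion of `x` into the decreasing tableau `T`. -/
def heckeInsert (T : List (List ℕ)) (x : ℕ) : List (List ℕ) × ℕ × Bool :=
  heckeGo (T.length + 2) T 0 x

theorem starLetter_of_forall_lt {S : Finset ℕ} {m : ℕ} (h : ∀ t ∈ S, t < m) :
    starLetter S m = insert m S := by
  rw [starLetter, dif_neg]
  rintro ⟨t, ht⟩
  have := h t (Finset.mem_filter.1 ht).1
  have := (Finset.mem_filter.1 ht).2
  omega

theorem starLetter_of_bump {S : Finset ℕ} {m p : ℕ} (hp : p ∈ S) (hmp : m ≤ p)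
    (h : ∀ t ∈ S, m ≤ t → p ≤ t) : starLetter S m = insert m (S.erase p) := by
  have hne : (S.filter (fun s => m ≤ s)).Nonempty := ⟨p, by simp [hp, hmp]⟩
  have hmin : (S.filter (fun s => m ≤ s)).min' hne = p := by
    apply le_antisymm
    · exact Finset.min'_le _ _ (by simp [hp, hmp])
    · refine Finset.le_min' _ _ _ fun t ht => ?_
      exact h t (Finset.mem_filter.1 ht).1 (Finset.mem_filter.1 ht).2
  rw [starLetter, dif_pos hne, hmin]

theorem exists_bump (S : Finset ℕ) (m : ℕ) :
    (∀ t ∈ S, t < m) ∨ ∃ p ∈ S, m ≤ p ∧ ∀ t ∈ S, m ≤ t → p ≤ t := by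
  by_cases h : (S.filter (fun s => m ≤ s)).Nonempty
  · right
    have hm := Finset.mem_filter.1 (Finset.min'_mem _ h)
    exact ⟨_, hm.1, hm.2, fun t ht hmt => Finset.min'_le _ _ (by simp [ht, hmt])⟩
  · left
    intro t ht
    by_contra hlt
    exact h ⟨t, by simp [ht]; omega⟩

theorem mem_starLetter {S : Finset ℕ} {m z : ℕ} :
    z ∈ starLetter S m ↔ z = m ∨ z ∈ S ∧ (z < m ∨ ∃ t ∈ S, m ≤ t ∧ t < z) := by
  rcases exists_bump S m with h | ⟨p, hp, hmp, h⟩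
  · rw [starLetter_of_forall_lt h]
    grind
  · rw [starLetter_of_bump hp hmp h]
    grind

theorem starLetter_of_mem {S : Finset ℕ} {m : ℕ} (h : m ∈ S) : starLetter S m = S := by
  rw [starLetter_of_bump h le_rfl fun _ _ => id, Finset.insert_erase h]

theorem self_mem_starLetter (S : Finset ℕ) (m : ℕ) : m ∈ starLetter S m :=
  mem_starLetter.2 (Or.inl rfl)

theorem starLetter_mono {A B : Finset ℕ} (h : B ⊆ A) (m : ℕ) :
    starLetter B m ⊆ starLetter A m := by
  intro z hz
  rw [mem_starLetter] at *
  grind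

theorem starLetter_comm {S : Finset ℕ} {a b c : ℕ} (hb : b ∈ S) (hab : a ≤ b) (hbc : b < c) :
    starLetter (starLetter S a) c = starLetter (starLetter S c) a := by
  obtain h | ⟨p, hp, hap, hpm⟩ := exists_bump S a
  · grind
  have hpb := hpm b hb hab
  rw [starLetter_of_bump hp hap hpm]
  rcases exists_bump S c with h | ⟨q, hq, hcq, hqm⟩
  · rw [starLetter_of_forall_lt h, starLetter_of_forall_lt (by grind),
      starLetter_of_bump (p := p) (by grind) hap (by grind)]
    grind
  · rw [starLetter_of_bump hq hcq hqm, starLetter_of_bump (p := q) (by grind) hcq (by grind),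
      starLetter_of_bump (p := p) (by grind) hap (by grind)]
    grind

theorem starLetter_knuth {S : Finset ℕ} {a b c : ℕ} (hab : a < b) (hbc : b ≤ c) :
    starLetter (starLetter (starLetter S c) a) b =
      starLetter (starLetter (starLetter S a) c) b := by
  by_cases hx : ∃ p ∈ S, a ≤ p ∧ p < c
  · obtain ⟨p, hp, hap, hpc⟩ := hx
    rw [starLetter_comm hp hap hpc]
  · have hgap : ∀ t ∈ S, t < a ∨ c ≤ t := by grind
    rcases exists_bump S c with h | ⟨p, hp, hcp, hpm⟩
    · rw [starLetter_of_forall_lt h,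
        starLetter_of_bump (m := a) (p := c) (by grind) (by omega) (by grind),
        starLetter_of_forall_lt (m := a) (S := S) (by grind),
        starLetter_of_forall_lt (m := b) (by grind),
        starLetter_of_forall_lt (m := c) (by grind),
        starLetter_of_bump (p := c) (by grind) (by omega) (by grind)]
      grind
    · rw [starLetter_of_bump hp hcp hpm,
        starLetter_of_bump (m := a) (p := c) (by grind) (by omega) (by grind),
        starLetter_of_bump (S := S) (m := a) (p := p) hp (by omega) (by grind)]
      rcases exists_bump (S.erase p) c with h | ⟨q, hq, hcq, hqm⟩
      · rw [starLetter_of_forall_lt (m := b) (by grind),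
          starLetter_of_forall_lt (m := c) (by grind),
          starLetter_of_bump (p := c) (by grind) (by omega) (by grind)]
        grind
      · rw [starLetter_of_bump (m := b) (p := q) (by grind) (by omega) (by grind),
          starLetter_of_bump (m := c) (p := q) (by grind) (by omega) (by grind),
          starLetter_of_bump (p := c) (by grind) (by omega) (by grind)]
        grind

theorem star_nil (S : Finset ℕ) : star S [] = S := rfl

theorem star_cons (S : Finset ℕ) (m : ℕ) (w : List ℕ) :
    star S (m :: w) = star (starLetter S m) w := rfl

theorem star_append (S : Finset ℕ) (v w : List ℕ) : star S (v ++ w) = star (star S v) w :=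
  List.foldl_append

theorem star_mono {A B : Finset ℕ} (h : B ⊆ A) (w : List ℕ) : star B w ⊆ star A w := by
  induction w generalizing A B with
  | nil => exact h
  | cons m w ih => exact ih (starLetter_mono h m)

theorem subset_star {S : Finset ℕ} {w : List ℕ} (hw : w.Pairwise (· < ·)) :
    ∀ z, (z ∈ w ∨ z ∈ S ∧ ∀ m ∈ w, z < m) → z ∈ star S w := by
  induction w generalizing S with
  | nil => simp [star_nil]
  | cons m w ih =>
    intro z hz
    rw [star_cons]
    apply ih hw.of_cons
    rw [List.pairwise_cons] at hw
    rw [mem_starLetter]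
    simp only [List.mem_cons, forall_eq_or_imp] at hz
    rcases hz with (rfl | hz) | ⟨hz, hzm, hzw⟩
    · exact Or.inr ⟨Or.inl rfl, hw.1⟩
    · exact Or.inl hz
    · exact Or.inr ⟨Or.inr ⟨hz, Or.inl hzm⟩, hzw⟩

/-- A letter larger than all letters of an increasing word but the last moves past
all of them except the last. -/
theorem star_cons_append_last {S : Finset ℕ} {x y : ℕ} {u : List ℕ}
    (hu : (u ++ [y]).Pairwise (· < ·)) (hyx : y ≤ x) :
    star S (x :: (u ++ [y])) = star S (u ++ [x, y]) := by
  induction u generalizing S with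
  | nil => rfl
  | cons a u ih =>
    have hu' : (u ++ [y]).Pairwise (· < ·) := hu.of_cons
    rw [List.cons_append, List.pairwise_cons] at hu
    have hay : a < y := hu.1 y (by simp)
    rw [List.cons_append, List.cons_append, star_cons S a, ← ih hu', star_cons, star_cons,
      star_cons]
    cases u with
    | nil =>
      simp only [List.nil_append, star_cons]
      rw [starLetter_knuth hay hyx]
    | cons b u =>
      have hab : a < b := hu.1 b (by simp)
      have hby : b < y := (List.pairwise_cons.1 hu').1 y (by simp)
      simp only [List.cons_append, star_cons]
      rw [starLetter_knuth hab (by omega)]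

theorem star_comm_of_mem {S : Finset ℕ} {x y : ℕ} {v : List ℕ} (hx : x ∈ S)
    (hv : (x :: v).Pairwise (· < ·)) (hyx : y ≤ x) :
    star S (y :: v) = star S (v ++ [y]) := by
  induction v generalizing S x with
  | nil => rfl
  | cons a v ih =>
    have hxa : x < a := (List.pairwise_cons.1 hv).1 a (by simp)
    rw [List.cons_append, star_cons S a,
      ← ih (self_mem_starLetter S a) hv.of_cons (by omega), star_cons, star_cons, star_cons,
      starLetter_comm hx hyx hxa]

/-- Column insertion in which `x` replaces `y` does not change the `⋆` action. -/
theorem star_insert_replace {S : Finset ℕ} {x y : ℕ} {u v : List ℕ}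
    (hu : (u ++ [y]).Pairwise (· < ·)) (hv : (x :: v).Pairwise (· < ·)) (hyx : y < x) :
    star S (x :: (u ++ y :: v)) = star S (u ++ x :: v ++ [y]) := by
  rw [show x :: (u ++ y :: v) = (x :: (u ++ [y])) ++ v by simp, star_append,
    star_cons_append_last hu hyx.le, ← star_append,
    show u ++ [x, y] ++ v = u ++ (x :: y :: v) by simp,
    show u ++ x :: v ++ [y] = u ++ (x :: (v ++ [y])) by simp, star_append, star_append, star_cons,
    star_comm_of_mem (self_mem_starLetter _ x) hv hyx.le, star_cons _ x (v ++ [y])]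

/-- Inserting a letter already present, and not minimal, in a column does not
change the `⋆` action. -/
theorem star_insert_mem {S : Finset ℕ} {x : ℕ} {w : List ℕ} (hw : w.Pairwise (· < ·))
    (hx : x ∈ w) : star S (x :: w) = star S w := by
  obtain ⟨s, v, rfl⟩ := List.append_of_mem hx
  rcases List.eq_nil_or_concat' s with rfl | ⟨u, y, rfl⟩
  · simp only [List.nil_append, star_cons]
    rw [starLetter_of_mem (self_mem_starLetter S x)]
  · have hp := List.pairwise_append.1 hw
    have hyx : y < x := hp.2.2 y (by simp) x (by simp)
    rw [show x :: (u ++ [y] ++ x :: v) = (x :: (u ++ [y])) ++ x :: v by simp, star_append,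
      star_cons_append_last hp.1 hyx.le]
    simp only [star_append, star_cons, star_nil]
    rw [starLetter_knuth hyx le_rfl, starLetter_of_mem (self_mem_starLetter _ x)]

theorem card_star_of_lt {w : List ℕ} (hw : w.Pairwise (· < ·)) {S : Finset ℕ}
    (hS : ∀ t ∈ S, ∀ m ∈ w, t < m) : (star S w).card = S.card + w.length := by
  induction w generalizing S with
  | nil => simp [star_nil]
  | cons m w ih =>
    have hm : ∀ t ∈ S, t < m := fun t ht => hS t ht m (by simp)
    rw [List.pairwise_cons] at hw
    rw [star_cons, starLetter_of_forall_lt hm, ih hw.2 (by grind),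
      Finset.card_insert_of_notMem fun h => (hm m h).false, List.length_cons]
    omega

/-- Column `D` can stand immediately to the right of column `C` in a decreasing tableau. -/
def Fits (C D : List ℕ) : Prop :=
  D.length ≤ C.length ∧ ∀ r : ℕ, r < D.length → D.getD r 0 < C.getD r 0

theorem isDecTab_iff {T : List (List ℕ)} :
    IsDecTab T ↔ ∀ j, (T.getD j []).Pairwise (· > ·) ∧ Fits (T.getD j []) (T.getD (j + 1) []) := by
  have hcol : ∀ C : List ℕ, List.IsChain (· > ·) C ↔ C.Pairwise (· > ·) := fun C =>
    List.isChain_iff_pairwise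
  constructor
  · rintro ⟨h₁, h₂⟩ j
    constructor
    · by_cases hj : j < T.length
      · rw [List.getD_eq_getElem _ _ hj]
        exact (hcol _).1 (h₁ _ (List.getElem_mem hj))
      · rw [List.getD_eq_default _ _ (by omega)]
        exact List.Pairwise.nil
    · by_cases hj : j + 1 < T.length
      · rw [List.getD_eq_getElem _ _ hj, List.getD_eq_getElem _ _ (by omega)]
        exact List.IsChain.getElem h₂ j hj
      · rw [List.getD_eq_default T _ (n := j + 1) (by omega)]
        exact ⟨by simp, by simp⟩
  · intro h
    constructor
    · intro C hC
      obtain ⟨j, hj, rfl⟩ := List.getElem_of_mem hC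
      have := (h j).1
      rw [List.getD_eq_getElem _ _ hj] at this
      exact (hcol _).2 this
    · refine List.isChain_iff_getElem.2 fun j hj => ?_
      have := (h j).2
      rw [List.getD_eq_getElem _ _ hj, List.getD_eq_getElem _ _ (by omega)] at this
      exact this

theorem star_reverse_of_fits {C D : List ℕ} (hC : C.Pairwise (· > ·)) {S : Finset ℕ}
    (hS : ∀ z ∈ C, z ∈ S) (hCD : Fits C D) :
    (star S D.reverse).card = S.card ∧ ∀ e ∈ S, (∀ z ∈ C, z < e) → e ∈ star S D.reverse := by
  induction D generalizing C with
  | nil => exact ⟨rfl, fun e he _ => he⟩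
  | cons d D ih =>
    cases C with
    | nil => simp [Fits] at hCD
    | cons c C =>
      rw [List.pairwise_cons] at hC
      have hdc : d < c := by simpa using hCD.2 0 (by simp)
      have hfit : Fits C D := ⟨by simpa using hCD.1, fun r hr => by
        simpa using hCD.2 (r + 1) (by simpa using hr)⟩
      obtain ⟨hcard, hmem⟩ := ih hC.2 (fun z hz => hS z (by simp [hz])) hfit
      have hc := hmem c (hS c (by simp)) hC.1
      rw [List.reverse_cons, star_append, star_cons, star_nil]
      constructor
      · obtain h | ⟨p, hp, hdp, hpm⟩ := exists_bump (star S D.reverse) d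
        · exact absurd (h c hc) (by omega)
        · rw [starLetter_of_bump hp hdp hpm, ← hcard]
          by_cases hd : d = p
          · subst hd
            rw [Finset.insert_erase hp]
          · rw [Finset.card_insert_of_notMem (by grind), Finset.card_erase_add_one hp]
      · intro e he hlt
        simp only [List.mem_cons, forall_eq_or_imp] at hlt
        exact mem_starLetter.2 (Or.inr ⟨hmem e he hlt.2, Or.inr ⟨c, hc, hdc.le, hlt.1⟩⟩)

theorem colWord_drop (T : List (List ℕ)) (j : ℕ) :
    colWord (T.drop j) = (T.getD j []).reverse ++ colWord (T.drop (j + 1)) := by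
  by_cases hj : j < T.length
  · rw [List.drop_eq_getElem_cons hj, List.getD_eq_getElem _ _ hj]
    simp only [colWord, List.map_cons, List.flatten_cons]
  · rw [List.getD_eq_default _ _ (by omega), List.drop_eq_nil_of_le (by omega),
      List.drop_eq_nil_of_le (by omega)]
    rfl

theorem pairwise_reverse_lt {C : List ℕ} (hC : C.Pairwise (· > ·)) :
    C.reverse.Pairwise (· < ·) :=
  List.pairwise_reverse.2 hC

theorem mem_star_reverse {C : List ℕ} (hC : C.Pairwise (· > ·)) (S : Finset ℕ) {z : ℕ}
    (hz : z ∈ C) : z ∈ star S C.reverse :=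
  subset_star (pairwise_reverse_lt hC) z (Or.inl (List.mem_reverse.2 hz))

theorem card_star_colWord_drop {T : List (List ℕ)} (hT : IsDecTab T) (n j : ℕ)
    (hn : T.length ≤ j + n) {S : Finset ℕ} (hS : ∀ z ∈ T.getD j [], z ∈ S) :
    (star S (colWord (T.drop (j + 1)))).card = S.card := by
  induction n generalizing j S with
  | zero =>
    rw [List.drop_eq_nil_of_le (by omega)]
    rfl
  | succ n ih =>
    have hD := isDecTab_iff.1 hT
    rw [colWord_drop, star_append, ih (j + 1) (by omega)
      fun z hz => mem_star_reverse (hD (j + 1)).1 S hz]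
    exact (star_reverse_of_fits (hD j).1 hS (hD j).2).1

/-- The columns of the right key have the same lengths as those of the tableau. -/
theorem card_Kcol {T : List (List ℕ)} (hT : IsDecTab T) (j : ℕ) :
    (Kcol T j).card = (T.getD j []).length := by
  have hC := (isDecTab_iff.1 hT j).1
  rw [Kcol, colWord_drop, star_append, card_star_colWord_drop hT T.length j (by omega)
    fun z hz => mem_star_reverse hC ∅ hz, card_star_of_lt (pairwise_reverse_lt hC) (by simp)]
  simp

theorem getD_setCol {T : List (List ℕ)} {c : ℕ} (hc : c ≤ T.length) (C : List ℕ) (j : ℕ) :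
    (setCol T c C).getD j [] = if j = c then C else T.getD j [] := by
  unfold setCol
  split_ifs <;> grind

theorem drop_setCol {T : List (List ℕ)} {c j : ℕ} (hc : c ≤ T.length) (C : List ℕ) (hj : c < j) :
    (setCol T c C).drop j = T.drop j := by
  unfold setCol
  split_ifs
  · rw [List.drop_set_of_lt hj]
  · rw [List.drop_eq_nil_of_le (by simp; omega), List.drop_eq_nil_of_le (by omega)]

theorem take_setCol {T : List (List ℕ)} {c : ℕ} (hc : c ≤ T.length) (C : List ℕ) :
    (setCol T c C).take c = T.take c := by
  unfold setCol
  split_ifs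
  · rw [List.take_set_of_le le_rfl]
  · rw [List.take_append_of_le_length hc]

theorem isDecTab_setCol {T : List (List ℕ)} (hT : IsDecTab T) {c : ℕ} (hc : c ≤ T.length)
    {C : List ℕ} (hC : C.Pairwise (· > ·)) (hr : Fits C (T.getD (c + 1) []))
    (hl : c = 0 ∨ Fits (T.getD (c - 1) []) C) : IsDecTab (setCol T c C) := by
  rw [isDecTab_iff] at *
  intro j
  have := hT j
  simp only [getD_setCol hc]
  grind

theorem le_getD_append {A : List ℕ} {x : ℕ} (hA : ∀ a ∈ A, x ≤ a) (B : List ℕ) {i : ℕ}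
    (hi : i < A.length) : x ≤ (A ++ B).getD i 0 := by
  rw [List.getD_append _ _ _ _ hi, List.getD_eq_getElem _ _ hi]
  exact hA _ (List.getElem_mem hi)

/-- Every position which a letter `x` may take in column `D`, by the entries of `D` alone,
is to the right of a larger entry of the column `L`. -/
def IsFree (L D : List ℕ) (x : ℕ) : Prop :=
  ∀ s ≤ D.length, (∀ i < s, x ≤ D.getD i 0) → s < L.length ∧ x < L.getD s 0

theorem Fits.replace_left {A B D : List ℕ} {x y : ℕ} (h : Fits (A ++ y :: B) D) (hyx : y ≤ x) :
    Fits (A ++ x :: B) D := by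
  refine ⟨by simpa using h.1, fun r hr => (h.2 r hr).trans_le ?_⟩
  grind

theorem Fits.replace_right {L A B : List ℕ} {x y : ℕ} (h : Fits L (A ++ y :: B))
    (hA : ∀ a ∈ A, x ≤ a) (hx : IsFree L (A ++ y :: B) x) : Fits L (A ++ x :: B) := by
  refine ⟨by simpa using h.1, fun r hr => ?_⟩
  have h₁ := (hx A.length (by simp) fun i hi => le_getD_append hA _ hi).2
  have h₂ := h.2 r (by simpa using hr)
  grind

theorem Fits.append_left {C D : List ℕ} {x : ℕ} (h : Fits C D) : Fits (C ++ [x]) D := by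
  refine ⟨by simpa using h.1.trans (Nat.le_succ _), fun r hr => ?_⟩
  have h₁ := h.1
  have h₂ := h.2 r hr
  grind

theorem Fits.append_right {L C : List ℕ} {x : ℕ} (h : Fits L C) (hC : ∀ a ∈ C, x ≤ a)
    (hx : IsFree L C x) : Fits L (C ++ [x]) := by
  have h₁ := hx C.length le_rfl fun i hi => by simpa using le_getD_append hC [] hi
  refine ⟨by simpa using h₁.1, fun r hr => ?_⟩
  have h₂ := h.2 r
  grind

theorem Fits.isFree_bump {A B D : List ℕ} {x y : ℕ} (h : Fits (A ++ y :: B) D)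
    (hA : ∀ a ∈ A, x ≤ a) (hyx : y < x) : IsFree (A ++ x :: B) D y := by
  intro s hs hlt
  have hsA : s ≤ A.length := by
    by_contra hlen
    have h₁ := hlt A.length (by omega)
    have h₂ := h.2 A.length (by omega)
    grind
  have hle : s < A.length → x ≤ (A ++ x :: B).getD s 0 := le_getD_append hA _
  grind

theorem exists_eq_append_bump {C : List ℕ} (hC : C.Pairwise (· > ·)) {x : ℕ}
    (hx : ¬ ∀ y ∈ C, x ≤ y) :
    ∃ A y B, C = A ++ y :: B ∧ (∀ a ∈ A, x ≤ a) ∧ y < x ∧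
      (C.filter (fun z => decide (z < x))).foldr max 0 = y ∧
      C.map (fun z => if z = y then x else z) = A ++ x :: B := by
  induction C with
  | nil => simp at hx
  | cons c C ih =>
    rw [List.pairwise_cons] at hC
    by_cases hcx : c < x
    · refine ⟨[], c, C, rfl, by simp, hcx, ?_, ?_⟩
      · rw [List.filter_cons_of_pos (by simpa using hcx), List.foldr_cons]
        have hle : ∀ l : List ℕ, (∀ z ∈ l, z < c) → l.foldr max 0 ≤ c := by
          intro l hl
          induction l with
          | nil => simp
          | cons z l ih =>
            exact max_le (hl z (by simp)).le (ih fun w hw => hl w (by simp [hw]))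
        exact max_eq_left (hle _ fun z hz => hC.1 z (List.mem_of_mem_filter hz))
      · rw [List.map_cons, if_pos rfl, List.nil_append]
        congr 1
        exact (List.map_congr_left (by grind)).trans (List.map_id _)
    · obtain ⟨A, y, B, rfl, hA, hyx, hfold, hmap⟩ := ih hC.2 (by grind)
      refine ⟨c :: A, y, B, rfl, by grind, hyx, ?_, ?_⟩
      · rw [List.filter_cons_of_neg (by simpa using hcx), hfold]
      · rw [List.map_cons, hmap, if_neg (by omega), List.cons_append]

theorem pairwise_replace {A B : List ℕ} {x y : ℕ} (h : (A ++ y :: B).Pairwise (· > ·))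
    (hA : ∀ a ∈ A, x ≤ a) (hxA : x ∉ A) (hyx : y < x) : (A ++ x :: B).Pairwise (· > ·) := by
  rw [List.pairwise_append, List.pairwise_cons] at *
  grind

theorem star_insert_bump {A B : List ℕ} {x y : ℕ} (hy : (A ++ y :: B).Pairwise (· > ·))
    (hx : (A ++ x :: B).Pairwise (· > ·)) (hyx : y < x) (S : Finset ℕ) :
    star S (x :: (A ++ y :: B).reverse) = star S ((A ++ x :: B).reverse ++ [y]) := by
  have hu : (B.reverse ++ [y]).Pairwise (· < ·) := by
    simpa using pairwise_reverse_lt (List.pairwise_append.1 hy).2.1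
  have hv : (x :: A.reverse).Pairwise (· < ·) := by
    simpa using pairwise_reverse_lt (hx.sublist (l₁ := A ++ [x]) (by simp))
  simpa using star_insert_replace (S := S) hu hv hyx

theorem getD_eq_of_take_eq {T R : List (List ℕ)} {c : ℕ} (h : R.take (c + 1) = T.take (c + 1)) :
    R.getD c [] = T.getD c [] := by
  have := congrArg (fun l => l[c]?) h
  simp only [List.getElem?_take_of_succ] at this
  rw [List.getD_eq_getElem?_getD, this, List.getD_eq_getElem?_getD]

theorem take_eq_of_take_succ_eq {T R : List (List ℕ)} {c : ℕ}
    (h : R.take (c + 1) = T.take (c + 1)) : R.take c = T.take c := by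
  simpa [List.take_take] using congrArg (List.take c) h

theorem Kcol_eq_of_star_cons {T R : List (List ℕ)} (hT : IsDecTab T) (hR : IsDecTab R) {j x : ℕ}
    (hlen : (R.getD j []).length = (T.getD j []).length)
    (h : star ∅ (colWord (R.drop j)) = star ∅ (x :: colWord (T.drop j))) :
    Kcol R j = Kcol T j := by
  symm
  apply Finset.eq_of_subset_of_card_le
  · rw [Kcol, Kcol, h]
    exact star_mono (Finset.empty_subset _) _
  · rw [card_Kcol hR, card_Kcol hT, hlen]

/-- Inserting `x` from column `c` on acts on a set `S` as reading `x` first, provided that the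
column to the left of `c` is no obstacle for `x` or that `S` contains `x`. All columns of the
right key from `c` on, except the one in which a box is added, are preserved. -/
theorem heckeGo_spec (fuel : ℕ) {T : List (List ℕ)} (hT : IsDecTab T) {c : ℕ} (x : ℕ)
    (hc : c ≤ T.length) (hf : T.length < fuel + c) :
    IsDecTab (heckeGo fuel T c x).1 ∧ (heckeGo fuel T c x).1.take c = T.take c ∧
    (∀ S : Finset ℕ, (c = 0 ∨ IsFree (T.getD (c - 1) []) (T.getD c []) x) ∨ x ∈ S →
      star S (colWord ((heckeGo fuel T c x).1.drop c)) = star S (x :: colWord (T.drop c))) ∧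
    ∀ j ≥ c, (heckeGo fuel T c x).2.2 = false ∨ j ≠ (heckeGo fuel T c x).2.1 →
      ((heckeGo fuel T c x).1.getD j []).length = (T.getD j []).length ∧
      Kcol (heckeGo fuel T c x).1 j = Kcol T j := by
  induction fuel generalizing T c x with
  | zero => omega
  | succ fuel ih =>
    have hD := isDecTab_iff.1 hT
    have hCp := (hD c).1
    have hl : c = 0 ∨ Fits (T.getD (c - 1) []) (T.getD c []) := by
      rcases c with _ | c
      · exact Or.inl rfl
      · exact Or.inr (hD c).2
    have hr := (hD c).2
    have hword := colWord_drop T c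
    rw [heckeGo]
    generalize hC : T.getD c [] = C at *
    simp only
    by_cases hx : ∀ y ∈ C, x ≤ y
    · rw [if_pos hx]
      by_cases hdec : IsDecTab (setCol T c (C ++ [x]))
      · rw [if_pos hdec]
        refine ⟨hdec, take_setCol hc _, fun S _ => ?_, fun j hj hjc => ?_⟩
        · rw [colWord_drop, getD_setCol hc, if_pos rfl, drop_setCol hc _ (Nat.lt_succ_self c), hword]
          simp
        · have hne : j ≠ c := by simpa using hjc
          rw [getD_setCol hc, if_neg hne, Kcol, drop_setCol hc _ (by omega)]
          exact ⟨rfl, rfl⟩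
      · rw [if_neg hdec]
        refine ⟨hT, rfl, fun S hS => ?_, fun j _ _ => ⟨rfl, rfl⟩⟩
        rcases hS with hfree | hS
        · have hxC : x ∈ C := by
            by_contra hxC
            refine hdec (isDecTab_setCol hT hc ?_ hr.append_left ?_)
            · rw [List.pairwise_append]
              grind
            · rcases hl with hl | hl
              · exact Or.inl hl
              · exact hfree.imp_right fun h => hl.append_right hx h
          rw [hword, ← List.cons_append, star_append, star_append S,
            star_insert_mem (pairwise_reverse_lt hCp) (List.mem_reverse.2 hxC)]
        · rw [star_cons, starLetter_of_mem hS]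
    · rw [if_neg hx]
      obtain ⟨A, y, B, hAB, hA, hyx, hfold, hmap⟩ := exists_eq_append_bump hCp hx
      rw [hfold, hmap]
      have hcT : c < T.length := by
        by_contra hcT
        rw [List.getD_eq_default _ _ (by omega)] at hC
        simp [← hC] at hAB
      have hset : T.set c (A ++ x :: B) = setCol T c (A ++ x :: B) := by
        rw [setCol, if_pos hcT]
      rw [hset]
      have hyC : y ∈ C := by simp [hAB]
      by_cases hdec : IsDecTab (setCol T c (A ++ x :: B))
      · rw [if_pos hdec]
        have hlen : (setCol T c (A ++ x :: B)).length = T.length := by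
          rw [← hset, List.length_set]
        obtain ⟨hR, htake, hstar, hK⟩ := ih hdec (c := c + 1) y (by omega) (by omega)
        generalize heckeGo fuel (setCol T c (A ++ x :: B)) (c + 1) y = R at *
        have hRc : R.1.getD c [] = A ++ x :: B := by
          rw [getD_eq_of_take_eq htake, getD_setCol hc, if_pos rfl]
        have hfree : IsFree ((setCol T c (A ++ x :: B)).getD (c + 1 - 1) [])
            ((setCol T c (A ++ x :: B)).getD (c + 1) []) y := by
          rw [getD_setCol hc, getD_setCol hc, if_pos (by omega), if_neg (by omega)]
          exact (hAB ▸ hr).isFree_bump hA hyx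
        have hxp : (A ++ x :: B).Pairwise (· > ·) := by
          have := (isDecTab_iff.1 hR c).1
          rwa [hRc] at this
        have hstep : ∀ S, star S (colWord (R.1.drop c)) = star S (x :: colWord (T.drop c)) := by
          intro S
          rw [colWord_drop, hRc, star_append, hstar _ (Or.inl (Or.inr hfree)),
            drop_setCol hc _ (Nat.lt_succ_self c), hword, ← List.cons_append, star_append S, hAB,
            star_insert_bump (hAB ▸ hCp) hxp hyx, star_append S, star_cons, star_cons, star_nil]
        refine ⟨hR, (take_eq_of_take_succ_eq htake).trans (take_setCol hc _), fun S _ => hstep S,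
          fun j hj hjR => ?_⟩
        rcases hj.eq_or_lt with rfl | hj
        · have hlenc : (R.1.getD c []).length = (T.getD c []).length := by
            rw [hRc, hC, hAB]
            simp
          exact ⟨hlenc, Kcol_eq_of_star_cons hT hR hlenc (hstep ∅)⟩
        · obtain ⟨h₁, h₂⟩ := hK j hj hjR
          rw [h₁, h₂, getD_setCol hc, if_neg (by omega), Kcol, drop_setCol hc _ hj]
          exact ⟨rfl, rfl⟩
      · rw [if_neg hdec]
        obtain ⟨hR, htake, hstar, hK⟩ := ih hT (c := c + 1) y (by omega) (by omega)
        generalize heckeGo fuel T (c + 1) y = R at *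
        have hRc : R.1.getD c [] = C := (getD_eq_of_take_eq htake).trans hC
        have hstep : ∀ S, star S (colWord (R.1.drop c)) = star S (colWord (T.drop c)) := by
          intro S
          have hy := mem_star_reverse hCp S hyC
          rw [colWord_drop, hRc, star_append, hstar _ (Or.inr hy), hword, star_append S, star_cons,
            starLetter_of_mem hy]
        refine ⟨hR, take_eq_of_take_succ_eq htake, fun S hS => ?_, fun j hj hjR => ?_⟩
        · rw [hstep]
          rcases hS with hfree | hS
          · have hxC : x ∈ C := by
              by_contra hxC
              refine hdec (isDecTab_setCol hT hc ?_ ?_ ?_)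
              · exact pairwise_replace (hAB ▸ hCp) hA (by grind) hyx
              · exact (hAB ▸ hr).replace_left hyx.le
              · rcases hl with hl | hl
                · exact Or.inl hl
                · exact hfree.imp_right fun h => (hAB ▸ hl).replace_right hA (hAB ▸ h)
            rw [hword, ← List.cons_append, star_append, star_append S,
              star_insert_mem (pairwise_reverse_lt hCp) (List.mem_reverse.2 hxC)]
          · rw [star_cons, starLetter_of_mem hS]
        · rcases hj.eq_or_lt with rfl | hj
          · exact ⟨by rw [hRc, hC], hstep ∅⟩
          · exact hK j hj hjR

/-- **Right key change under Hecke insertion.**  Let `P'` be a decreasing tableau,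
`x` a value, and `P` the result of Hecke column insertion of `x` into `P'`, with
the insertion ending at column `c`.  Then `K₊(P)` and `K₊(P')` agree in every
column except possibly column `c`; and if the insertion causes a contraction (no
box is added), then `K₊(P) = K₊(P')`. -/
theorem stmt18 (P' : List (List ℕ)) (hP' : IsDecTab P') (x : ℕ) :
    (∀ j : ℕ, j ≠ (heckeInsert P' x).2.1 →
      Kcol (heckeInsert P' x).1 j = Kcol P' j) ∧
    ((heckeInsert P' x).2.2 = false →
      ∀ j : ℕ, Kcol (heckeInsert P' x).1 j = Kcol P' j) := by
  obtain ⟨-, -, -, h⟩ := heckeGo_spec (P'.length + 2) hP' x (Nat.zero_le _) (by omega)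
  exact ⟨fun j hj => (h j (Nat.zero_le j) (Or.inr hj)).2,
    fun hc j => (h j (Nat.zero_le j) (Or.inl hc)).2⟩

end
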